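/- arXiv:1007.3460 — 2 statements merged into one kernel-verified Lean document; each statement's English description precedes it below -/
import Mathlib

section
/- For every nonzero real number a, with b = min(a, ln 2), one has ∫_0^{π/2} ln(x² + ln²(2 e^{−a} cos x)) dx = π · ln(a/(e^b − 1)). -/
open Real

lemma aux_slit {z : ℂ} (hz : ‖z‖ < 1) : 1 + z ∈ Complex.slitPlane := by
  left
  have := Complex.abs_re_le_norm z
  have := neg_abs_le z.re
  simp; linarith

lemma aux_exp_lip {M : ℝ} (hM : 0 ≤ M) {u : ℂ} (hu : u.re ≤ M) :
    ‖Complex.exp u - 1‖ ≤ Real.exp M * ‖u‖ := by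
  have h := Convex.norm_image_sub_le_of_norm_deriv_le (𝕜 := ℂ) (f := Complex.exp)
    (C := Real.exp M) (s := {c : ℂ | c.re ≤ M}) (x := 0) (y := u)
    (fun x _ => Complex.differentiable_exp x)
    (fun x hx => by
      simp only [Complex.deriv_exp, Complex.norm_exp]
      exact Real.exp_le_exp.mpr hx)
    (convex_halfSpace_re_le M) (by simpa using hM) hu
  simpa using h

lemma aux_lower (a : ℝ) {z : ℂ} (hz : ‖1 + z‖ ≤ 2) (h0 : 1 + z ≠ 0) :
    Real.exp (-(max 0 (Real.log 2 - a)) - a) * ‖z - ((Real.exp a - 1 : ℝ) : ℂ)‖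
      ≤ ‖Complex.log (1 + z) - a‖ := by
  set M := max 0 (Real.log 2 - a)
  set u := Complex.log (1 + z) - a with hu
  have hre : u.re ≤ M := by
    have : Real.log ‖1 + z‖ ≤ Real.log 2 := Real.log_le_log (norm_pos_iff.mpr h0) hz
    have h2 : Real.log 2 - a ≤ M := le_max_right _ _
    simp only [hu, Complex.sub_re, Complex.log_re, Complex.ofReal_re]
    linarith
  have h := aux_exp_lip (le_max_left 0 (Real.log 2 - a)) hre
  have he : Complex.exp u - 1 = ((Real.exp (-a) : ℝ) : ℂ) * (z - ((Real.exp a - 1 : ℝ) : ℂ)) := by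
    have h1 : Complex.exp (-(a:ℂ)) * Complex.exp a = 1 := by
      rw [← Complex.exp_add]; simp
    rw [hu, sub_eq_add_neg (Complex.log _), Complex.exp_add, Complex.exp_log h0]
    push_cast
    linear_combination h1
  rw [he, norm_mul, Complex.norm_real, Real.norm_of_nonneg (Real.exp_pos _).le] at h
  have : Real.exp (-M - a) = Real.exp (-M) * Real.exp (-a) := by rw [← Real.exp_add]; ring_nf
  rw [this, mul_assoc]
  calc _ ≤ Real.exp (-M) * (Real.exp M * ‖u‖) := by gcongr
    _ = ‖u‖ := by rw [← mul_assoc, ← Real.exp_add]; simp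

lemma aux_ne (a : ℝ) {z : ℂ} (hz : ‖z‖ < 1) (hne : z ≠ ((Real.exp a - 1 : ℝ) : ℂ)) :
    Complex.log (1 + z) - a ≠ 0 := by
  have h := aux_lower a (z := z) ((norm_add_le _ _).trans (by simp; linarith))
    (Complex.slitPlane_ne_zero (aux_slit hz))
  have : 0 < ‖z - ((Real.exp a - 1 : ℝ) : ℂ)‖ := norm_pos_iff.mpr (sub_ne_zero.mpr hne)
  rw [← norm_pos_iff]
  exact lt_of_lt_of_le (by positivity) h

lemma aux_diff (a : ℝ) : DifferentiableOn ℂ (fun z : ℂ => Complex.log (1 + z) - a)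
    (Metric.ball 0 1) := by
  intro z hz
  apply DifferentiableAt.differentiableWithinAt
  have := aux_slit (z := z) (by simpa using hz)
  fun_prop (disch := assumption)

lemma aux_sub {r : ℝ} (h0 : 0 < r) (h1 : r < 1) :
    Metric.closedBall (0:ℂ) |r| ⊆ Metric.ball 0 1 := by
  rw [abs_of_pos h0]; exact Metric.closedBall_subset_ball h1

lemma aux_jensen_A (a : ℝ) (ha : Real.log 2 ≤ a) {r : ℝ} (h0 : 0 < r) (h1 : r < 1) :
    circleAverage (fun z : ℂ => Real.log ‖Complex.log (1 + z) - a‖) 0 r = Real.log a := by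
  have hs := aux_sub h0 h1
  rw [AnalyticOnNhd.circleAverage_log_norm_of_ne_zero (g := fun z : ℂ => Complex.log (1 + z) - a)]
  · simp
  · exact ((aux_diff a).analyticOnNhd Metric.isOpen_ball).mono hs
  · intro u hu
    have hu1 : ‖u‖ < 1 := by simpa using hs hu
    apply aux_ne a hu1
    rintro rfl
    have : 2 ≤ Real.exp a := by
      rwa [← Real.log_le_iff_le_exp (by norm_num)]
    rw [Complex.norm_real, Real.norm_of_nonneg (by linarith)] at hu1
    linarith

lemma aux_jensen_B (a : ℝ) (hane : a ≠ 0) {r : ℝ} (h0 : 0 < r) (h1 : r < 1)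
    (hr : |Real.exp a - 1| < r) :
    circleAverage (fun z : ℂ => Real.log ‖Complex.log (1 + z) - a‖) 0 r
      = Real.log r + Real.log (a / (Real.exp a - 1)) := by
  have hs := aux_sub h0 h1
  set z0 : ℂ := ((Real.exp a - 1 : ℝ) : ℂ) with hz0
  set f : ℂ → ℂ := fun z : ℂ => Complex.log (1 + z) - a with hf
  have hz0n : ‖z0‖ < r := by rw [hz0, Complex.norm_real]; exact hr
  have hz01 : ‖z0‖ < 1 := by linarith
  have hfz0 : f z0 = 0 := by
    simp only [hf, hz0]
    rw [show (1:ℂ) + ((Real.exp a - 1 : ℝ) : ℂ) = ((Real.exp a : ℝ) : ℂ) by push_cast; ring,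
      ← Complex.ofReal_log (Real.exp_pos a).le, Real.log_exp, sub_self]
  set g := dslope f z0 with hg
  have hgd : DifferentiableOn ℂ g (Metric.ball 0 1) :=
    (Complex.differentiableOn_dslope (Metric.isOpen_ball.mem_nhds (by simpa using hz01))).mpr
      (aux_diff a)
  have hfg : ∀ z, f z = (z - z0) * g z := fun z => by
    have := sub_smul_dslope f z0 z
    rw [hfz0, sub_zero, smul_eq_mul] at this
    exact this.symm
  have hg0 : ∀ z ∈ Metric.closedBall (0:ℂ) |r|, g z ≠ 0 := by
    intro z hz
    have hz1 : ‖z‖ < 1 := by simpa using hs hz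
    by_cases h : z = z0
    · have hd : HasDerivAt f (1 / (1 + z0)) z0 := by
        have := (((hasDerivAt_id z0).const_add 1).clog (aux_slit hz01)).sub_const (a:ℂ)
        simpa only [id] using this
      rw [h, hg, dslope_same, hd.deriv]
      exact one_div_ne_zero (Complex.slitPlane_ne_zero (aux_slit hz01))
    · intro h'
      apply aux_ne a hz1 h
      have := hfg z
      rw [h', mul_zero] at this
      exact this
  have hga := (hgd.analyticOnNhd Metric.isOpen_ball).mono hs
  have hJ := AnalyticOnNhd.circleAverage_log_norm_of_ne_zero hga hg0
  have hz0ne : Real.exp a - 1 ≠ 0 := by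
    simpa [sub_eq_zero] using hane
  have hg00 : ‖g 0‖ = |a / (Real.exp a - 1)| := by
    have h := hfg 0
    simp only [hf] at h
    have h2 : ‖(a:ℂ)‖ = ‖z0‖ * ‖g 0‖ := by
      rw [← norm_neg (a:ℂ), ← norm_neg z0, ← norm_mul]; congr 1
      simpa using h
    rw [hz0, Complex.norm_real, Complex.norm_real, Real.norm_eq_abs, Real.norm_eq_abs] at h2
    rw [abs_div, h2]
    field_simp
  have hI := circleAverage_log_norm_sub_const_of_mem_closedBall (a := z0) (c := 0) (R := r)
    (by simpa [abs_of_pos h0] using hz0n.le)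
  have hci : CircleIntegrable (fun z => Real.log ‖g z‖) 0 r := by
    apply MeromorphicOn.circleIntegrable_log_norm
    intro x hx
    exact (hga x (Metric.sphere_subset_closedBall hx)).meromorphicAt
  rw [hg00, Real.log_abs] at hJ
  rw [← hI, ← hJ, ← circleAverage_add (circleIntegrable_log_norm_sub_const r) hci]
  apply circleAverage_congr_sphere
  intro z hz
  have hzr : ‖z‖ = r := by simpa [abs_of_pos h0] using hz
  have hzz : z - z0 ≠ 0 := by
    rw [sub_ne_zero]; rintro rfl; linarith
  have hgz := hg0 z (Metric.sphere_subset_closedBall hz)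
  simp only [Pi.add_apply]
  change Real.log ‖f z‖ = _
  rw [hfg z, norm_mul, Real.log_mul (norm_ne_zero_iff.mpr hzz) (norm_ne_zero_iff.mpr hgz)]

lemma aux_half {w s : ℂ} (hw : ‖w‖ = 1) (hs : ‖s‖ = 1) {r : ℝ} (h0 : 0 ≤ r) (h1 : r ≤ 1) :
    ‖w - s‖ ≤ 2 * ‖r * w - s‖ := by
  have e : w - s = (r * w - s) + ((1 - r : ℝ) : ℂ) * w := by push_cast; ring
  have h2 : ‖((1 - r : ℝ) : ℂ) * w‖ = 1 - r := by
    rw [norm_mul, hw, Complex.norm_real, Real.norm_of_nonneg (by linarith), mul_one]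
  have h3 : ‖(r:ℂ) * w‖ = r := by
    rw [norm_mul, hw, Complex.norm_real, Real.norm_of_nonneg h0, mul_one]
  have h4 := norm_sub_norm_le s (r * w)
  rw [norm_sub_rev, h3, hs] at h4
  have h5 := norm_add_le (r * w - s) (((1 - r : ℝ) : ℂ) * w)
  rw [← e, h2] at h5
  linarith

lemma aux_sep (t : ℝ) (ht : -1 < t) : ∃ r0 : ℝ, 0 < r0 ∧ r0 < 1 ∧ |min t 0| < 1 ∧ (t < 1 → |t| < r0) ∧
    ∃ c : ℝ, 0 < c ∧ ∀ r : ℝ, r0 < r → r ≤ 1 → ∀ w : ℂ, ‖w‖ = 1 →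
      c * ‖w - 1‖ ≤ ‖r * w - t‖ := by
  have hm : |min t 0| < 1 := by
    rw [abs_lt]; constructor
    · exact lt_min ht (by norm_num)
    · exact lt_of_le_of_lt (min_le_right _ _) one_pos
  by_cases h : t < 1
  · have hta : |t| < 1 := abs_lt.mpr ⟨ht, h⟩
    have := abs_nonneg t
    refine ⟨(1 + |t|) / 2, by linarith, by linarith, hm, fun _ => by linarith, (1 - |t|) / 4,
      by linarith, ?_⟩
    intro r hr hr1 w hw
    have h3 : ‖(r:ℂ) * w‖ = r := by
      rw [norm_mul, hw, Complex.norm_real, Real.norm_of_nonneg (by linarith), mul_one]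
    have h4 := norm_sub_norm_le ((r:ℂ) * w) t
    rw [h3, Complex.norm_real, Real.norm_eq_abs] at h4
    have h5 : ‖w - 1‖ ≤ 2 := (norm_sub_le _ _).trans (by simp [hw]; norm_num)
    nlinarith
  · push Not at h
    refine ⟨1 / 2, by norm_num, by norm_num, hm, fun h' => by linarith, 1 / 2, by norm_num, ?_⟩
    intro r hr hr1 w hw
    have h1 := aux_half hw (norm_one (α := ℂ)) (by linarith : 0 ≤ r) hr1
    have h2 : ‖r * w - 1‖ ≤ ‖r * w - t‖ := by
      rw [Complex.norm_def, Complex.norm_def]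
      apply Real.sqrt_le_sqrt
      have hre : r * w.re ≤ 1 := by
        have := (Complex.abs_re_le_norm w)
        have := le_abs_self w.re
        nlinarith
      simp only [Complex.normSq_apply, Complex.sub_re, Complex.sub_im, Complex.re_ofReal_mul,
        Complex.im_ofReal_mul, Complex.one_re, Complex.one_im, Complex.ofReal_re, Complex.ofReal_im]
      nlinarith
    linarith

lemma aux_dom (a : ℝ) : ∃ r0 : ℝ, 0 < r0 ∧ r0 < 1 ∧
    (a < Real.log 2 → |Real.exp a - 1| < r0) ∧
    ∃ K : ℝ, ∀ r : ℝ, r0 < r → r ≤ 1 → ∀ w : ℂ, ‖w‖ = 1 → w.im ≠ 0 →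
      1 + r * w ∈ Complex.slitPlane ∧ Complex.log (1 + r * w) - a ≠ 0 ∧
      |Real.log ‖Complex.log (1 + r * w) - a‖| ≤
        K + |Real.log ‖w - (-1)‖| + |Real.log ‖w - 1‖| := by
  obtain ⟨r0, h0, h1, -, hs, c, hc, H⟩ :=
    aux_sep (Real.exp a - 1) (by linarith [Real.exp_pos a])
  refine ⟨r0, h0, h1, fun h => hs ?_, ?_⟩
  · have := (Real.lt_log_iff_exp_lt (by norm_num : (0:ℝ) < 2)).mp h
    linarith
  set D := Real.exp (-(max 0 (Real.log 2 - a)) - a) with hD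
  have hDp : 0 < D := Real.exp_pos _
  refine ⟨2 * Real.log 2 + π + |a| + |Real.log (D * c)|, ?_⟩
  intro r hr hr1 w hw him
  have hrp : 0 < r := by linarith
  have hz : 1 + r * w ∈ Complex.slitPlane := by
    right
    simp [him, hrp.ne']
  have hzne := Complex.slitPlane_ne_zero hz
  have hw1 : 0 < ‖w - 1‖ := by
    rw [norm_pos_iff, sub_ne_zero]; rintro rfl; simp at him
  have hwm1 : 0 < ‖w - (-1)‖ := by
    rw [norm_pos_iff, sub_ne_zero]; rintro rfl; simp at him
  have h3 : ‖(r:ℂ) * w‖ = r := by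
    rw [norm_mul, hw, Complex.norm_real, Real.norm_of_nonneg (by linarith), mul_one]
  have hz2 : ‖1 + r * w‖ ≤ 2 := (norm_add_le _ _).trans (by rw [h3, norm_one]; linarith)
  have hlow := aux_lower a hz2 hzne
  have hlow2 : (D * c) * ‖w - 1‖ ≤ ‖Complex.log (1 + r * w) - a‖ := by
    refine le_trans ?_ hlow
    rw [mul_assoc]
    exact mul_le_mul_of_nonneg_left (H r hr hr1 w hw) hDp.le
  have hpos : 0 < ‖Complex.log (1 + r * w) - a‖ := lt_of_lt_of_le (by positivity) hlow2
  refine ⟨hz, norm_pos_iff.mp hpos, ?_⟩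
  have hl2 : 0 < Real.log 2 := Real.log_pos (by norm_num)
  have hlb : Real.log (D * c) + Real.log ‖w - 1‖ ≤ Real.log ‖Complex.log (1 + r * w) - a‖ := by
    rw [← Real.log_mul (by positivity) hw1.ne']
    exact Real.log_le_log (by positivity) hlow2
  have hhalf := aux_half hw (s := -1) (by simp) hrp.le hr1
  have hcomm : (r:ℂ) * w - -1 = 1 + r * w := by ring
  rw [hcomm] at hhalf
  have hl1 : Real.log ‖w - (-1)‖ ≤ Real.log 2 + Real.log ‖1 + r * w‖ := by
    rw [← Real.log_mul (by norm_num) (norm_ne_zero_iff.mpr hzne)]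
    exact Real.log_le_log hwm1 hhalf
  have hl3 : Real.log ‖1 + r * w‖ ≤ Real.log 2 :=
    Real.log_le_log (norm_pos_iff.mpr hzne) hz2
  have hub : ‖Complex.log (1 + r * w) - a‖ ≤ |Real.log ‖1 + r * w‖| + π + |a| := by
    refine (norm_sub_le _ _).trans ?_
    rw [Complex.norm_real, Real.norm_eq_abs]
    have := Complex.norm_le_abs_re_add_abs_im (Complex.log (1 + r * w))
    rw [Complex.log_re, Complex.log_im] at this
    have := Complex.abs_arg_le_pi (1 + r * w)
    linarith
  have hub2 : Real.log ‖Complex.log (1 + r * w) - a‖ ≤ ‖Complex.log (1 + r * w) - a‖ :=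
    Real.log_le_self hpos.le
  have hab : |Real.log ‖1 + r * w‖| ≤ Real.log 2 + |Real.log ‖w - (-1)‖| := by
    rw [abs_le]
    have := neg_abs_le (Real.log ‖w - (-1)‖)
    have := abs_nonneg (Real.log ‖w - (-1)‖)
    constructor <;> linarith
  have n1 := neg_abs_le (Real.log ‖w - 1‖)
  have n2 := abs_nonneg (Real.log ‖w - 1‖)
  have n3 := abs_nonneg (Real.log ‖w - (-1)‖)
  have n4 := neg_abs_le (Real.log (D * c))
  have n5 := abs_nonneg (Real.log (D * c))
  have n6 := abs_nonneg a
  have n7 := Real.pi_pos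
  rw [abs_le]
  constructor <;> linarith

lemma aux_ae : ∀ᵐ θ : ℝ, Real.sin θ ≠ 0 := by
  have : (Set.range (fun n : ℤ => (n:ℝ) * π)).Countable := Set.countable_range _
  refine MeasureTheory.measure_mono_null ?_ (this.measure_zero MeasureTheory.volume)
  intro x hx
  simp only [Set.mem_compl_iff, Set.mem_ofPred_eq, not_not] at hx
  exact Real.sin_eq_zero_iff.mp hx

lemma aux_cm (r θ : ℝ) : circleMap 0 r θ = r * circleMap 0 1 θ := by simp [circleMap]

lemma aux_cm_im (θ : ℝ) : (circleMap 0 1 θ).im = Real.sin θ := by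
  simp [circleMap, Complex.exp_ofReal_mul_I_im]

lemma aux_cm_norm (θ : ℝ) : ‖circleMap 0 1 θ‖ = 1 := by simp

lemma aux_bound_int (K : ℝ) : IntervalIntegrable (fun θ : ℝ => K +
    |Real.log ‖circleMap 0 1 θ - (-1)‖| + |Real.log ‖circleMap 0 1 θ - 1‖|)
    MeasureTheory.volume 0 (2 * π) := by
  have h1 : CircleIntegrable (fun z : ℂ => Real.log ‖z - (-1)‖) 0 1 :=
    circleIntegrable_log_norm_sub_const 1
  have h2 : CircleIntegrable (fun z : ℂ => Real.log ‖z - 1‖) 0 1 :=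
    circleIntegrable_log_norm_sub_const 1
  exact (intervalIntegrable_const.add (IntervalIntegrable.abs h1)).add (IntervalIntegrable.abs h2)

lemma aux_meas (a r : ℝ) : Measurable (fun θ : ℝ =>
    Real.log ‖Complex.log (1 + circleMap 0 r θ) - a‖) := by
  have : Measurable (circleMap 0 r) := (continuous_circleMap 0 r).measurable
  fun_prop

lemma aux_int (a : ℝ) : IntervalIntegrable (fun θ : ℝ =>
    Real.log ‖Complex.log (1 + circleMap 0 1 θ) - a‖) MeasureTheory.volume 0 (2 * π) := by
  obtain ⟨r0, h0, h1, -, K, H⟩ := aux_dom a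
  refine (aux_bound_int K).mono_fun (aux_meas a 1).aestronglyMeasurable ?_
  filter_upwards [MeasureTheory.ae_restrict_of_ae aux_ae] with θ hθ
  have := (H 1 h1 le_rfl _ (aux_cm_norm θ) (by rwa [aux_cm_im])).2.2
  rw [Complex.ofReal_one, one_mul] at this
  exact this.trans (le_abs_self _)

lemma aux_tendsto (a : ℝ) : Filter.Tendsto (fun r : ℝ => circleAverage
    (fun z : ℂ => Real.log ‖Complex.log (1 + z) - a‖) 0 r) (nhdsWithin 1 (Set.Iio 1))
    (nhds (circleAverage (fun z : ℂ => Real.log ‖Complex.log (1 + z) - a‖) 0 1)) := by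
  obtain ⟨r0, h0, h1, -, K, H⟩ := aux_dom a
  simp only [circleAverage_def]
  apply Filter.Tendsto.const_smul
  apply intervalIntegral.tendsto_integral_filter_of_dominated_convergence _ _ _ (aux_bound_int K)
  · filter_upwards [aux_ae] with θ hθ _
    obtain ⟨hs, hne, -⟩ := H 1 h1 le_rfl _ (aux_cm_norm θ) (by rwa [aux_cm_im])
    have : ContinuousAt (fun r : ℝ => Real.log ‖Complex.log (1 + r * circleMap 0 1 θ) - a‖) 1 := by
      refine ContinuousAt.log ?_ (norm_ne_zero_iff.mpr hne)
      refine ContinuousAt.norm (ContinuousAt.sub (ContinuousAt.clog ?_ hs) continuousAt_const)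
      fun_prop
    have h := this.tendsto.mono_left (nhdsWithin_le_nhds (s := Set.Iio 1))
    simp only [← aux_cm] at h
    exact h
  · filter_upwards with r
    exact (aux_meas a r).aestronglyMeasurable
  · filter_upwards [Ioo_mem_nhdsLT h1] with r hr
    filter_upwards [aux_ae] with θ hθ _
    have := (H r hr.1 hr.2.le _ (aux_cm_norm θ) (by rwa [aux_cm_im])).2.2
    rw [← aux_cm] at this
    exact this

lemma aux_avg (a : ℝ) (ha : a ≠ 0) :
    circleAverage (fun z : ℂ => Real.log ‖Complex.log (1 + z) - a‖) 0 1
      = Real.log (a / (Real.exp (min a (Real.log 2)) - 1)) := by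
  have ht := aux_tendsto a
  obtain ⟨r0, h0, h1, hr0, -⟩ := aux_dom a
  refine tendsto_nhds_unique ht ?_
  by_cases h : a < Real.log 2
  · rw [min_eq_left h.le]
    have hc : Filter.Tendsto (fun r : ℝ => Real.log r + Real.log (a / (Real.exp a - 1)))
        (nhdsWithin 1 (Set.Iio 1)) (nhds (Real.log (a / (Real.exp a - 1)))) := by
      have := (Real.continuousAt_log one_ne_zero).tendsto.mono_left
        (nhdsWithin_le_nhds (s := Set.Iio (1:ℝ)))
      simpa using this.add_const (Real.log (a / (Real.exp a - 1)))
    refine hc.congr' ?_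
    filter_upwards [Ioo_mem_nhdsLT h1] with r hr
    exact (aux_jensen_B a ha (h0.trans hr.1) hr.2 ((hr0 h).trans hr.1)).symm
  · push Not at h
    rw [min_eq_right h, Real.exp_log (by norm_num)]
    norm_num
    refine tendsto_const_nhds.congr' ?_
    filter_upwards [Ioo_mem_nhdsLT h1] with r hr
    exact (aux_jensen_A a h (h0.trans hr.1) hr.2).symm

lemma aux_point (a : ℝ) {x : ℝ} (h0 : 0 < x) (h1 : x < π / 2) :
    Real.log (x ^ 2 + Real.log (2 * Real.exp (-a) * Real.cos x) ^ 2)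
      = 2 * Real.log ‖Complex.log (1 + circleMap 0 1 (2 * x)) - a‖ := by
  have hc : 0 < Real.cos x := Real.cos_pos_of_mem_Ioo ⟨by linarith, h1⟩
  have h2 : (1:ℂ) + circleMap 0 1 (2 * x)
      = Complex.exp ((Real.log (2 * Real.cos x) : ℝ) + x * Complex.I) := by
    rw [Complex.exp_add, ← Complex.ofReal_exp, Real.exp_log (by positivity)]
    push_cast
    rw [Complex.two_cos, add_mul, ← Complex.exp_add, ← Complex.exp_add]
    simp [circleMap]
    ring_nf
  have h3 : Complex.log (1 + circleMap 0 1 (2 * x))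
      = (Real.log (2 * Real.cos x) : ℝ) + x * Complex.I := by
    rw [h2, Complex.log_exp] <;> simp <;> linarith
  have h4 : Real.log (2 * Real.exp (-a) * Real.cos x) = Real.log (2 * Real.cos x) - a := by
    rw [show 2 * Real.exp (-a) * Real.cos x = (2 * Real.cos x) * Real.exp (-a) by ring,
      Real.log_mul (by positivity) (Real.exp_pos _).ne', Real.log_exp]
    ring
  rw [h3, h4, ← Nat.cast_ofNat (R := ℝ) (n := 2), ← Real.log_pow, Complex.sq_norm,
    Complex.normSq_apply]
  congr 1
  simp
  ring

lemma aux_symm (a θ : ℝ) : ‖Complex.log (1 + circleMap 0 1 (2 * π - θ)) - a‖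
    = ‖Complex.log (1 + circleMap 0 1 θ) - a‖ := by
  have hcm : 1 + circleMap 0 1 (2 * π - θ) = (starRingEnd ℂ) (1 + circleMap 0 1 θ) := by
    simp only [circleMap, map_add, map_one, map_mul, ← Complex.exp_conj]
    simp [sub_mul, Complex.exp_sub, Complex.exp_neg, Complex.exp_two_pi_mul_I]
  by_cases h : (1:ℂ) + circleMap 0 1 θ = 0
  · rw [hcm, h]; simp
  · have harg : (1 + circleMap 0 1 θ).arg ≠ π := by
      rw [Ne, Complex.arg_eq_pi_iff, not_and_or]
      left
      have := Complex.abs_re_le_norm (circleMap 0 1 θ)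
      rw [aux_cm_norm] at this
      have := (abs_le.mp this).1
      simp; linarith
    rw [hcm, Complex.log_conj _ harg, ← Complex.norm_conj (Complex.log (1 + circleMap 0 1 θ) - a)]
    simp

/-- For nonzero real `a`, with `b = min(a, ln 2)`,
`∫_0^{π/2} ln(x² + ln²(2 e^{-a} cos x)) dx = π ln(a/(e^b − 1))`. -/
theorem integral_log_sq_add_log_sq_shifted (a : ℝ) (ha : a ≠ 0)
    (b : ℝ) (hb : b = min a (Real.log 2)) :
    ∫ x in (0:ℝ)..(π/2),
        Real.log (x ^ 2 + Real.log (2 * Real.exp (-a) * Real.cos x) ^ 2)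
    = π * Real.log (a / (Real.exp b - 1)) := by
  have hpi := Real.pi_pos
  have havg := aux_avg a ha
  rw [← hb, circleAverage_def] at havg
  set G : ℝ → ℝ := fun θ => Real.log ‖Complex.log (1 + circleMap 0 1 θ) - a‖ with hG
  have hint : IntervalIntegrable G MeasureTheory.volume 0 (2 * π) := aux_int a
  have hI1 : IntervalIntegrable G MeasureTheory.volume 0 π :=
    hint.mono_set (by rw [Set.uIcc_of_le hpi.le, Set.uIcc_of_le (by linarith)]
                      exact Set.Icc_subset_Icc le_rfl (by linarith))
  have hI2 : IntervalIntegrable G MeasureTheory.volume π (2 * π) :=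
    hint.mono_set (by rw [Set.uIcc_of_le (by linarith), Set.uIcc_of_le (by linarith)]
                      exact Set.Icc_subset_Icc hpi.le le_rfl)
  have hsplit := intervalIntegral.integral_add_adjacent_intervals hI1 hI2
  have hsym : ∫ θ in π..(2 * π), G θ = ∫ θ in (0:ℝ)..π, G θ := by
    have h := intervalIntegral.integral_comp_sub_left (a := 0) (b := π) G (2 * π)
    rw [show 2 * π - π = π by ring, sub_zero] at h
    rw [← h]
    apply intervalIntegral.integral_congr
    intro θ _
    simp only [hG, aux_symm]
  have hmain : ∫ x in (0:ℝ)..(π/2),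
      Real.log (x ^ 2 + Real.log (2 * Real.exp (-a) * Real.cos x) ^ 2)
      = ∫ x in (0:ℝ)..(π/2), 2 * G (2 * x) := by
    rw [intervalIntegral.integral_of_le (by linarith), intervalIntegral.integral_of_le (by linarith),
      MeasureTheory.integral_Ioc_eq_integral_Ioo, MeasureTheory.integral_Ioc_eq_integral_Ioo]
    apply MeasureTheory.setIntegral_congr_fun measurableSet_Ioo
    intro x hx
    exact aux_point a hx.1 hx.2
  rw [hmain, intervalIntegral.integral_const_mul,
    intervalIntegral.integral_comp_mul_left (f := G) two_ne_zero, ← havg]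
  change _ = π * ((2 * π)⁻¹ • ∫ θ in (0:ℝ)..(2 * π), G θ)
  rw [← hsplit, hsym, mul_zero, show 2 * (π / 2) = π by ring]
  simp only [smul_eq_mul]
  field_simp
  ring
end

section
/- ∫_0^{π/2} x · sin(2x) / (x² + ln²(cos x)) dx = π/(4 · (ln 2)²). -/
open Real

noncomputable def auxL (z : ℂ) : ℂ := Complex.log ((1 + z) / 2)

noncomputable def auxG (z : ℂ) : ℂ := (z + 1) / dslope auxL 1 z

lemma auxL_one : auxL 1 = 0 := by
  have : ((1:ℂ) + 1) / 2 = 1 := by norm_num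
  simp [auxL, this]

lemma aux_re {z : ℂ} (hz : ‖z‖ ≤ 1) (h : z ≠ -1) : 0 < ((1 + z) / 2).re := by
  have h1 : ((1 + z) / 2).re = (1 + z.re) / 2 := by
    rw [show (2:ℂ) = ((2:ℝ):ℂ) by norm_num, Complex.div_ofReal_re]; simp
  rw [h1]
  have h2 : z.re ^ 2 + z.im ^ 2 ≤ 1 := by
    have h3 := Complex.sq_norm z
    rw [Complex.normSq_apply] at h3
    nlinarith [norm_nonneg z]
  by_contra hc
  apply h
  have h4 : z.re = -1 := by nlinarith [sq_nonneg z.im]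
  have h5 : z.im = 0 := by
    rw [h4] at h2
    have : z.im ^ 2 = 0 := by nlinarith [sq_nonneg z.im]
    simpa using this
  apply Complex.ext <;> simp [h4, h5]

lemma auxL_hasDeriv {z : ℂ} (hz : ‖z‖ ≤ 1) (h : z ≠ -1) :
    HasDerivAt auxL ((1 + z)⁻¹) z := by
  have hre := aux_re hz h
  have h1 : HasDerivAt (fun z : ℂ => (1 + z) / 2) (1 / 2) z :=
    ((hasDerivAt_id z).const_add 1).div_const 2
  have h2 := h1.clog (Or.inl hre)
  have h3 : (1 + z) ≠ 0 := fun h0 => h (by linear_combination h0)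
  have h4 : (1 + z)⁻¹ = 1 / 2 / ((1 + z) / 2) := by field_simp
  rw [h4]
  exact h2

lemma auxL_ne {z : ℂ} (h : z ≠ -1) (h1 : z ≠ 1) : auxL z ≠ 0 := by
  intro h0
  have h3 : (1 + z) / 2 ≠ 0 := by
    intro h4
    apply h
    linear_combination 2 * h4
  have := Complex.exp_log h3
  unfold auxL at h0
  rw [h0, Complex.exp_zero] at this
  apply h1
  linear_combination -2 * this

lemma auxG_ne {z : ℂ} (h1 : z ≠ 1) : auxG z = (z ^ 2 - 1) / auxL z := by
  unfold auxG
  have : z - 1 ≠ 0 := sub_ne_zero.mpr h1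
  rw [dslope_of_ne _ h1, slope_def_field, auxL_one, sub_zero, div_div_eq_mul_div]
  congr 1; ring

lemma auxD_ne {z : ℂ} (hz : ‖z‖ ≤ 1) (h : z ≠ -1) : dslope auxL 1 z ≠ 0 := by
  by_cases h1 : z = 1
  · subst h1
    rw [dslope_same, (auxL_hasDeriv hz h).deriv]
    norm_num
  · rw [dslope_of_ne _ h1, slope_def_field, auxL_one, sub_zero]
    exact div_ne_zero (auxL_ne h h1) (sub_ne_zero.mpr h1)

lemma auxG_diff : DifferentiableOn ℂ auxG (Metric.ball 0 1) := by
  intro z hz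
  have hz' : ‖z‖ < 1 := by simpa using hz
  have h1 : z ≠ 1 := by rintro rfl; simp at hz'
  have h2 : z ≠ -1 := by rintro rfl; simp at hz'
  apply DifferentiableAt.differentiableWithinAt
  unfold auxG
  refine DifferentiableAt.div (by fun_prop) ?_ (auxD_ne hz'.le h2)
  exact (differentiableAt_dslope_of_ne h1).2 (auxL_hasDeriv hz'.le h2).differentiableAt

lemma auxG_contAt_neg : ContinuousAt auxG (-1) := by
  have h0 : auxG (-1) = 0 := by simp [auxG]
  unfold ContinuousAt
  rw [h0]
  have hlim : Filter.Tendsto (fun z : ℂ => ‖z ^ 2 - 1‖) (nhds (-1)) (nhds 0) := by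
    have : Continuous (fun z : ℂ => ‖z ^ 2 - 1‖) := by fun_prop
    simpa using this.tendsto (-1)
  refine squeeze_zero_norm' ?_ hlim
  have hc : ∀ᶠ z : ℂ in nhds (-1), ‖(1 + z) / 2‖ < Real.exp (-1) := by
    have : Continuous (fun z : ℂ => ‖(1 + z) / 2‖) := by fun_prop
    have h := this.tendsto (-1)
    exact h.eventually (gt_mem_nhds (by simp [Real.exp_pos]))
  filter_upwards [hc] with z hz
  by_cases hz1 : z = -1
  · rw [hz1, h0]; simp
  have hz2 : z ≠ 1 := by
    rintro rfl
    have : ((1:ℂ) + 1) / 2 = 1 := by norm_num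
    rw [this] at hz
    have : Real.exp (-1) < 1 := by simp
    simp at hz
    linarith
  rw [auxG_ne hz2, norm_div]
  have hpos : 0 < ‖(1 + z) / 2‖ := by
    rw [norm_pos_iff]
    intro h4
    apply hz1
    linear_combination 2 * h4
  have hl : Real.log ‖(1 + z) / 2‖ < -1 := (Real.log_lt_iff_lt_exp hpos).2 hz
  have h5 : 1 ≤ ‖auxL z‖ := by
    have := Complex.abs_re_le_norm (auxL z)
    have h6 : (auxL z).re = Real.log ‖(1 + z) / 2‖ := Complex.log_re _
    rw [h6, abs_of_neg (by linarith)] at this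
    linarith
  exact div_le_self (norm_nonneg _) h5

lemma auxG_cont : ContinuousOn auxG (Metric.closedBall 0 1) := by
  intro z hz
  have hz' : ‖z‖ ≤ 1 := by simpa using hz
  apply ContinuousAt.continuousWithinAt
  by_cases h2 : z = -1
  · rw [h2]; exact auxG_contAt_neg
  unfold auxG
  refine ContinuousAt.div (by fun_prop) ?_ (auxD_ne hz' h2)
  by_cases h1 : z = 1
  · subst h1
    exact continuousAt_dslope_same.2 (auxL_hasDeriv hz' h2).differentiableAt
  · exact (continuousAt_dslope_of_ne h1).2 (auxL_hasDeriv hz' h2).continuousAt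

lemma auxG_deriv : deriv auxG 0 = ((1 / Real.log 2 ^ 2 : ℝ) : ℂ) := by
  have h1 : HasDerivAt auxL ((1 + 0)⁻¹) 0 := auxL_hasDeriv (by simp) (by simp)
  have hL0 : auxL 0 = ((-Real.log 2 : ℝ) : ℂ) := by
    unfold auxL
    rw [← Real.log_inv, Complex.ofReal_log (by norm_num)]
    norm_num
  have hl : (Real.log 2 : ℂ) ≠ 0 := by
    exact_mod_cast (Real.log_pos (by norm_num)).ne'
  have h2 : HasDerivAt (fun z : ℂ => z ^ 2 - 1) (2 * 0) 0 := by
    simpa using ((hasDerivAt_id (0:ℂ)).pow 2).sub_const 1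
  have h3 := h2.div h1 (by rw [hL0]; simpa using hl)
  have h4 : auxG =ᶠ[nhds 0] (fun z : ℂ => z ^ 2 - 1) / auxL := by
    filter_upwards [isOpen_ne.mem_nhds (show (0:ℂ) ≠ 1 by norm_num)] with z hz
    exact auxG_ne hz
  rw [(h3.congr_of_eventuallyEq h4).deriv, hL0]
  simp

noncomputable def auxH (θ : ℝ) : ℂ :=
  Complex.I * Complex.exp (-(θ * Complex.I)) * auxG (Complex.exp (θ * Complex.I))

lemma auxH_cont : Continuous auxH := by
  unfold auxH
  refine Continuous.mul (by fun_prop) ?_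
  refine auxG_cont.comp_continuous (by fun_prop) ?_
  intro x
  simp [Complex.norm_exp_ofReal_mul_I]

lemma auxH_per : Function.Periodic auxH (2 * π) := by
  intro x
  have h : Complex.exp (((x + 2 * π : ℝ) : ℂ) * Complex.I) = Complex.exp (x * Complex.I) := by
    push_cast
    rw [add_mul, Complex.exp_add, Complex.exp_two_pi_mul_I, mul_one]
  unfold auxH
  rw [Complex.exp_neg, Complex.exp_neg, h]

lemma auxH_int : ∫ θ in (-π)..π, auxH θ =
    ((2 * π / Real.log 2 ^ 2 : ℝ) : ℂ) * Complex.I := by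
  have hd : DiffContOnCl ℂ auxG (Metric.ball 0 1) := by
    refine ⟨auxG_diff, ?_⟩
    rw [closure_ball _ (by norm_num)]
    exact auxG_cont
  have h := hd.deriv_eq_smul_circleIntegral (by norm_num : (0:ℝ) < 1)
  rw [auxG_deriv] at h
  have h1 : (∮ z in C(0, 1), (1 / (z - 0) ^ 2) • auxG z) = ∫ θ in (0:ℝ)..(2 * π), auxH θ := by
    unfold circleIntegral
    apply intervalIntegral.integral_congr
    intro θ _
    simp only [deriv_circleMap, circleMap, auxH, smul_eq_mul, Complex.ofReal_one, one_mul,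
      zero_add, sub_zero, Complex.exp_neg]
    have := Complex.exp_ne_zero (θ * Complex.I)
    field_simp
  have h2 := auxH_per.intervalIntegral_add_eq (-π) 0
  rw [show -π + 2 * π = π by ring, zero_add] at h2
  rw [h2]
  have h3 := h
  rw [h1] at h3
  rw [h3, smul_eq_mul]
  push_cast
  ring

lemma auxH_im {x : ℝ} (h0 : x ≠ 0) (hx : x ∈ Set.Ioo (-(π / 2)) (π / 2)) :
    (auxH (2 * x)).im = 2 * (x * Real.sin (2 * x) / (x ^ 2 + Real.log (Real.cos x) ^ 2)) := by
  have hcos := Real.cos_pos_of_mem_Ioo hx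
  set w := Complex.exp (x * Complex.I) with hw
  have hw0 : w ≠ 0 := Complex.exp_ne_zero _
  have hz : Complex.exp (((2 * x : ℝ) : ℂ) * Complex.I) = w ^ 2 := by
    rw [hw, ← Complex.exp_nat_mul]; push_cast; ring_nf
  have hcw : (1 + w ^ 2) / 2 = (Real.cos x : ℂ) * w := by
    rw [Complex.ofReal_cos, Complex.cos, neg_mul, Complex.exp_neg, ← hw]
    field_simp
    ring
  have hL : auxL (w ^ 2) = Real.log (Real.cos x) + x * Complex.I := by
    unfold auxL
    rw [hcw, Complex.log_ofReal_mul hcos hw0, hw, Complex.log_exp]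
    · simp; linarith [hx.1, Real.pi_pos]
    · simp; linarith [hx.2, Real.pi_pos]
  have hne : w ^ 2 ≠ 1 := by
    intro h
    rw [h, auxL_one] at hL
    have := congrArg Complex.im hL
    simp at this
    exact h0 this.symm
  have hs : (w ^ 2)⁻¹ * ((w ^ 2) ^ 2 - 1) = 2 * Complex.I * (Real.sin (2 * x) : ℂ) := by
    rw [Complex.ofReal_sin, Complex.sin, neg_mul, Complex.exp_neg, hz]
    field_simp
    linear_combination (w ^ 4 - 1) * Complex.I_sq
  have hH : auxH (2 * x) = (-2 * Real.sin (2 * x) : ℝ) / (Real.log (Real.cos x) + x * Complex.I) := by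
    unfold auxH
    rw [Complex.exp_neg, hz, auxG_ne hne, hL, mul_assoc, ← mul_div_assoc, hs, ← mul_div_assoc]
    congr 1
    push_cast
    linear_combination 2 * Complex.sin (2 * x) * Complex.I_sq
  rw [hH, Complex.div_im]
  simp [Complex.normSq_apply, -Complex.ofReal_sin, -Complex.ofReal_cos]
  ring

theorem aux_half_s17 :
    ∫ x in (0:ℝ)..(π/2), (auxH (2 * x)).im = ∫ x in (0:ℝ)..(π/2),
        2 * (x * Real.sin (2 * x) / (x ^ 2 + Real.log (Real.cos x) ^ 2)) := by
  apply intervalIntegral.integral_congr_ae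
  filter_upwards [MeasureTheory.Measure.ae_ne MeasureTheory.volume (π/2)] with x hx h
  rw [Set.uIoc_of_le (by positivity)] at h
  exact auxH_im h.1.ne' ⟨by linarith [h.1, Real.pi_pos], lt_of_le_of_ne h.2 hx⟩

theorem aux_half' :
    ∫ x in (0:ℝ)..(π/2), (auxH (2 * (-x))).im = ∫ x in (0:ℝ)..(π/2),
        2 * (x * Real.sin (2 * x) / (x ^ 2 + Real.log (Real.cos x) ^ 2)) := by
  apply intervalIntegral.integral_congr_ae
  filter_upwards [MeasureTheory.Measure.ae_ne MeasureTheory.volume (π/2)] with x hx h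
  rw [Set.uIoc_of_le (by positivity)] at h
  rw [auxH_im (neg_ne_zero.2 h.1.ne')
    ⟨by linarith [lt_of_le_of_ne h.2 hx], by linarith [h.1, Real.pi_pos]⟩]
  simp

/-- `∫_0^{π/2} x sin 2x /(x² + ln²(cos x)) dx = π/(4 ln² 2)`. -/
theorem integral_x_sin_div_cos :
    ∫ x in (0:ℝ)..(π/2),
        x * Real.sin (2 * x) / (x ^ 2 + Real.log (Real.cos x) ^ 2)
    = π / (4 * Real.log 2 ^ 2) := by
  have hc : Continuous (fun θ => (auxH θ).im) := Complex.continuous_im.comp auxH_cont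
  have h1 : ∫ θ in (-π)..π, (auxH θ).im = 2 * π / Real.log 2 ^ 2 := by
    have := Complex.imCLM.intervalIntegral_comp_comm
      (auxH_cont.intervalIntegrable (μ := MeasureTheory.volume) (-π) π)
    rw [auxH_int] at this
    simpa only [Complex.imCLM_apply, Complex.im_ofReal_mul, Complex.I_im, mul_one] using this
  have hc2 : Continuous (fun x : ℝ => (auxH (2 * x)).im) := hc.comp (by fun_prop)
  have h2 := intervalIntegral.integral_comp_mul_left (a := -(π/2)) (b := π/2)
    (fun θ => (auxH θ).im) (two_ne_zero : (2:ℝ) ≠ 0)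
  rw [show 2 * -(π/2) = -π by ring, show 2 * (π/2) = π by ring, h1,
    ← intervalIntegral.integral_add_adjacent_intervals (b := 0)
      (hc2.intervalIntegrable _ _) (hc2.intervalIntegrable _ _)] at h2
  have h3 := intervalIntegral.integral_comp_neg (a := 0) (b := π/2)
    (fun x => (auxH (2 * x)).im)
  rw [neg_zero] at h3
  rw [← h3, aux_half', aux_half_s17, intervalIntegral.integral_const_mul, smul_eq_mul] at h2
  have hl : Real.log 2 ≠ 0 := (Real.log_pos (by norm_num)).ne'
  field_simp at h2 ⊢
  linarith
end
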